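/- arXiv:2210.14719 — 3 statements merged into one kernel-verified Lean document; each statement's English description precedes it below -/
import Mathlib

section
/- Let f be a folding instruction set and n ≥ 7 an integer, and write φ(n) = 2^k (so 2^(k-1) < n ≤ 2^k). Then S_f(n) = 4·φ(n) if f_{k+1} ≠ f_{k+2}, and S_f(n) = 6·φ(n) if f_{k+1} = f_{k+2}. -/
/-- A folding instruction set: a sequence with values in {-1, 1}. -/
def FoldingSeq (f : ℕ → ℤ) : Prop := ∀ s, f s = 1 ∨ f s = -1

/-- The paper-folding sequence `P_f`: if `k = 2^s * r` with `r` odd, then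
`P_f[k] = f s` if `r ≡ 1 [MOD 4]` and `P_f[k] = -f s` if `r ≡ 3 [MOD 4]`. -/
def PF (f : ℕ → ℤ) (k : ℕ) : ℤ :=
  if (k / 2 ^ (padicValNat 2 k)) % 4 = 1 then f (padicValNat 2 k)
  else -f (padicValNat 2 k)

/-- The length-`n` factors of `P_f` starting at indices `i` and `j` are identical. -/
def FactorMatch (f : ℕ → ℤ) (n i j : ℕ) : Prop :=
  ∀ t, t < n → PF f (i + t) = PF f (j + t)

/-- `Sf f n` : the least positive integer `m` such that every length-`n` factor of `P_f`
starts somewhere within the first `m` positions. -/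
noncomputable def Sf (f : ℕ → ℤ) (n : ℕ) : ℕ :=
  sInf {m | 1 ≤ m ∧ ∀ i, 1 ≤ i → ∃ j, 1 ≤ j ∧ j ≤ m ∧ FactorMatch f n i j}

/-- `Af f n` : the least positive integer `m` such that every length-`n` factor of `P_f`
appears entirely within the prefix `P_f[1..m]`. -/
noncomputable def Af (f : ℕ → ℤ) (n : ℕ) : ℕ :=
  sInf {m | 1 ≤ m ∧ ∀ i, 1 ≤ i → ∃ j, 1 ≤ j ∧ j + n - 1 ≤ m ∧ FactorMatch f n i j}

/-- `phi2 n` : the least power of 2 that is `≥ n`, i.e. `2 ^ ⌈log₂ n⌉`. -/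
def phi2 (n : ℕ) : ℕ := 2 ^ Nat.clog 2 n

theorem PF_pow_mul_one (f : ℕ → ℤ) (s q : ℕ) : PF f (2 ^ s * (4 * q + 1)) = f s := by
  have hv : padicValNat 2 (2 ^ s * (4 * q + 1)) = s := by
    rw [padicValNat.mul (by positivity) (by omega), padicValNat.prime_pow,
      padicValNat.eq_zero_of_not_dvd (by omega), add_zero]
  rw [PF, hv, Nat.mul_div_cancel_left _ (by positivity), if_pos (by omega)]

theorem PF_pow_mul_three (f : ℕ → ℤ) (s q : ℕ) : PF f (2 ^ s * (4 * q + 3)) = -f s := by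
  have hv : padicValNat 2 (2 ^ s * (4 * q + 3)) = s := by
    rw [padicValNat.mul (by positivity) (by omega), padicValNat.prime_pow,
      padicValNat.eq_zero_of_not_dvd (by omega), add_zero]
  rw [PF, hv, Nat.mul_div_cancel_left _ (by positivity), if_neg (by omega)]

theorem FoldingSeq.ne_neg {f : ℕ → ℤ} (hf : FoldingSeq f) (s : ℕ) : f s ≠ -f s := by
  rcases hf s with h | h <;> rw [h] <;> decide

theorem FoldingSeq.PF_eq {f : ℕ → ℤ} (hf : FoldingSeq f) (x : ℕ) : PF f x = 1 ∨ PF f x = -1 := by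
  unfold PF
  split_ifs <;> rcases hf (padicValNat 2 x) with h | h <;> simp [h]

/-- The value at a position which is not a multiple of `2 ^ K` only depends on the position
modulo `2 ^ (K + 1)`. -/
theorem PF_congr (f : ℕ → ℤ) {K x y : ℕ} (hx : ¬ 2 ^ K ∣ x) (h : x ≡ y [MOD 2 ^ (K + 1)]) :
    PF f x = PF f y := by
  have aux : ∀ z w, ¬ 2 ^ K ∣ z → PF f (z + 2 ^ (K + 1) * w) = PF f z := by
    intro z w hz
    have hz0 : z ≠ 0 := by rintro rfl; simp at hz
    obtain ⟨s, r, hr, rfl⟩ := Nat.exists_eq_two_pow_mul_odd hz0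
    have hs : s < K := by
      by_contra! hle
      exact hz ((pow_dvd_pow 2 hle).mul_right r)
    obtain ⟨e, rfl⟩ := Nat.exists_eq_add_of_lt hs
    have hr' : r = 4 * (r / 4) + 1 ∨ r = 4 * (r / 4) + 3 := by
      have := Nat.odd_iff.mp hr
      omega
    rcases hr' with hr' | hr' <;> rw [hr']
    · rw [show 2 ^ s * (4 * (r / 4) + 1) + 2 ^ (s + e + 1 + 1) * w
        = 2 ^ s * (4 * (r / 4 + 2 ^ e * w) + 1) by ring, PF_pow_mul_one, PF_pow_mul_one]
    · rw [show 2 ^ s * (4 * (r / 4) + 3) + 2 ^ (s + e + 1 + 1) * w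
        = 2 ^ s * (4 * (r / 4 + 2 ^ e * w) + 3) by ring, PF_pow_mul_three, PF_pow_mul_three]
  have hdvd : 2 ^ K ∣ 2 ^ (K + 1) := pow_dvd_pow 2 (Nat.le_succ K)
  rcases le_total x y with hle | hle
  · obtain ⟨w, hw⟩ := (Nat.modEq_iff_dvd' hle).mp h
    rw [show y = x + 2 ^ (K + 1) * w by omega, aux x w hx]
  · obtain ⟨w, hw⟩ := (Nat.modEq_iff_dvd' hle).mp h.symm
    have hy : ¬ 2 ^ K ∣ y := fun hy => hx ((h.dvd_iff hdvd).mpr hy)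
    rw [show x = y + 2 ^ (K + 1) * w by omega, aux y w hy]

/-- Two windows of length at most `2 ^ (K + 1)` at congruent positions match as soon as they
agree on the two multiples of `2 ^ K` they may contain. -/
theorem factorMatch_of_eq (f : ℕ → ℤ) {K n i j d m m' : ℕ} (hn : n ≤ 2 ^ (K + 1))
    (hd : d < 2 ^ K) (hi : i + d = 2 ^ K * m) (hj : j + d = 2 ^ K * m') (hm : m ≡ m' [MOD 2])
    (h0 : PF f (2 ^ K * m) = PF f (2 ^ K * m'))
    (h1 : PF f (2 ^ K * (m + 1)) = PF f (2 ^ K * (m' + 1))) : FactorMatch f n i j := by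
  intro t ht
  by_cases hdvd : 2 ^ K ∣ i + t
  · obtain ⟨w, hw⟩ := hdvd
    rw [pow_succ] at hn
    have hlo : m ≤ w := by
      by_contra! hlt
      have := Nat.mul_le_mul_left (2 ^ K) (Nat.succ_le_of_lt hlt)
      rw [Nat.succ_eq_add_one, mul_add] at this
      omega
    have hhi : w ≤ m + 1 := by
      by_contra! hlt
      have := Nat.mul_le_mul_left (2 ^ K) (Nat.succ_le_of_lt hlt)
      rw [Nat.succ_eq_add_one, mul_add, mul_add] at this
      omega
    obtain rfl | rfl : w = m ∨ w = m + 1 := by omega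
    · rw [hw, h0, show j + t = 2 ^ K * m' by omega]
    · rw [hw, h1]
      congr 1
      rw [mul_add] at hw ⊢
      omega
  · refine PF_congr f hdvd (Nat.ModEq.add_right t (Nat.ModEq.add_right_cancel' d ?_))
    rw [hi, hj, pow_succ]
    exact Nat.ModEq.mul_left' _ hm

/-- A window of length more than `2 ^ K` starting at a multiple of `2 ^ (K + 2)` can only match
windows which also start at a multiple of `2 ^ (K + 2)`. -/
theorem dvd_of_factorMatch {f : ℕ → ℤ} (hf : FoldingSeq f) {K n q j : ℕ} (hn : 7 ≤ n)
    (hK : 2 ≤ K) (hKn : 2 ^ K < n) (h : FactorMatch f n (2 ^ (K + 2) * q) j) :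
    2 ^ (K + 2) ∣ j := by
  have key : ∀ s, s ≤ K + 1 → 2 ^ (s + 1) ∣ j := by
    intro s
    induction s with
    | zero =>
      intro _
      by_contra hodd
      obtain ⟨e, rfl⟩ := Nat.exists_eq_add_of_le hK
      have hne := hf.ne_neg 1
      have h2 := h 2 (by omega)
      have h6 := h 6 (by omega)
      rw [show 2 ^ (2 + e + 2) * q + 2 = 2 ^ 1 * (4 * (2 ^ (e + 1) * q) + 1) by ring,
        PF_pow_mul_one] at h2
      rw [show 2 ^ (2 + e + 2) * q + 6 = 2 ^ 1 * (4 * (2 ^ (e + 1) * q) + 3) by ring,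
        PF_pow_mul_three] at h6
      have h26 : PF f (j + 2) = PF f (j + 6) := by
        refine PF_congr f (K := 1) ?_ ?_
        · omega
        · simp [Nat.ModEq]
          omega
      rw [h26, ← h6] at h2
      exact hne h2
    | succ s ih =>
      intro hs
      obtain ⟨z, rfl⟩ := ih (by omega)
      obtain ⟨e, rfl⟩ := Nat.exists_eq_add_of_le (show s ≤ K by omega)
      have hlt : 2 ^ s < n :=
        lt_of_le_of_lt (Nat.pow_le_pow_right (by norm_num) (by omega)) hKn
      rcases Nat.even_or_odd' z with ⟨y, rfl | rfl⟩
      · exact ⟨y, by ring⟩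
      · have hs' := h _ hlt
        rw [show 2 ^ (s + e + 2) * q + 2 ^ s = 2 ^ s * (4 * (2 ^ e * q) + 1) by ring,
          PF_pow_mul_one, show 2 ^ (s + 1) * (2 * y + 1) + 2 ^ s = 2 ^ s * (4 * y + 3) by ring,
          PF_pow_mul_three] at hs'
        exact absurd hs' (hf.ne_neg s)
  exact key (K + 1) le_rfl

/-- The pair of values at `2 ^ K * m`, `2 ^ K * (m + 1)` already occurs, with the same parity
of `m`, for some `m ≤ 4 * Q`, if all values at multiples of `2 ^ (K + 2)` occur up to `Q`. -/
theorem exists_eq_pair (f : ℕ → ℤ) {K Q : ℕ} (hQ : 2 ≤ Q)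
    (hocc : ∀ m, ∃ q, 1 ≤ q ∧ q ≤ Q ∧ PF f (2 ^ (K + 2) * m) = PF f (2 ^ (K + 2) * q))
    (m : ℕ) :
    ∃ m', 1 ≤ m' ∧ m' ≤ 4 * Q ∧ m ≡ m' [MOD 2] ∧ PF f (2 ^ K * m) = PF f (2 ^ K * m') ∧
      PF f (2 ^ K * (m + 1)) = PF f (2 ^ K * (m' + 1)) := by
  have e1 : ∀ q, PF f (2 ^ K * (4 * q + 1)) = f K := PF_pow_mul_one f K
  have e3 : ∀ q, PF f (2 ^ K * (4 * q + 3)) = -f K := PF_pow_mul_three f K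
  have e2 : ∀ q, PF f (2 ^ K * (8 * q + 2)) = f (K + 1) := fun q => by
    rw [← PF_pow_mul_one f (K + 1) q]; congr 1; ring
  have e6 : ∀ q, PF f (2 ^ K * (8 * q + 6)) = -f (K + 1) := fun q => by
    rw [← PF_pow_mul_three f (K + 1) q]; congr 1; ring
  have e4 : ∀ q, 2 ^ K * (4 * q) = 2 ^ (K + 2) * q := fun q => by ring
  have hcases : (∃ q, m = 8 * q + 1) ∨ (∃ q, m = 8 * q + 5) ∨ (∃ q, m = 8 * q + 2) ∨
      (∃ q, m = 8 * q + 6) ∨ (∃ q, m = 4 * q + 3) ∨ (∃ q, m = 4 * q) := by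
    have : m % 8 < 8 := Nat.mod_lt _ (by norm_num)
    have : m = 8 * (m / 8) + 1 ∨ m = 8 * (m / 8) + 5 ∨ m = 8 * (m / 8) + 2 ∨
      m = 8 * (m / 8) + 6 ∨ m = 4 * (m / 4) + 3 ∨ m = 4 * (m / 4) := by omega
    rcases this with h | h | h | h | h | h
    exacts [.inl ⟨_, h⟩, .inr (.inl ⟨_, h⟩), .inr (.inr (.inl ⟨_, h⟩)),
      .inr (.inr (.inr (.inl ⟨_, h⟩))), .inr (.inr (.inr (.inr (.inl ⟨_, h⟩)))),
      .inr (.inr (.inr (.inr (.inr ⟨_, h⟩))))]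
  rcases hcases with ⟨q, rfl⟩ | ⟨q, rfl⟩ | ⟨q, rfl⟩ | ⟨q, rfl⟩ | ⟨q, rfl⟩ | ⟨q, rfl⟩
  · refine ⟨1, le_rfl, by omega, by simp only [Nat.ModEq]; omega, ?_, ?_⟩
    · exact (show 8 * q + 1 = 4 * (2 * q) + 1 by ring) ▸ (e1 (2 * q)).trans (e1 0).symm
    · exact (e2 q).trans (e2 0).symm
  · refine ⟨5, by omega, by omega, by simp only [Nat.ModEq]; omega, ?_, ?_⟩
    · rw [show 8 * q + 5 = 4 * (2 * q + 1) + 1 by ring]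
      exact (e1 _).trans (e1 1).symm
    · exact (e6 q).trans (e6 0).symm
  · refine ⟨2, by omega, by omega, by simp only [Nat.ModEq]; omega, ?_, ?_⟩
    · exact (e2 q).trans (e2 0).symm
    · rw [show 8 * q + 2 + 1 = 4 * (2 * q) + 3 by ring]
      exact (e3 _).trans (e3 0).symm
  · refine ⟨6, by omega, by omega, by simp only [Nat.ModEq]; omega, ?_, ?_⟩
    · exact (e6 q).trans (e6 0).symm
    · rw [show 8 * q + 6 + 1 = 4 * (2 * q + 1) + 3 by ring]
      exact (e3 _).trans (e3 1).symm
  · obtain ⟨p, hp1, hpQ, hp⟩ := hocc (q + 1)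
    obtain ⟨p, rfl⟩ := Nat.exists_eq_add_of_le' hp1
    refine ⟨4 * p + 3, by omega, by omega, by simp only [Nat.ModEq]; omega, ?_, ?_⟩
    · rw [e3, e3]
    · rw [← e4, ← e4] at hp
      exact hp
  · obtain ⟨p, hp1, hpQ, hp⟩ := hocc q
    refine ⟨4 * p, by omega, by omega, by simp only [Nat.ModEq]; omega, ?_, ?_⟩
    · rw [e4, e4, hp]
    · rw [e1, e1]

/-- If the values at multiples of `2 ^ (K + 2)` all occur among the first `Q` of them, and the
`Q`-th one does not occur earlier, then every window of length `n` starts by `Q * 2 ^ (K + 2)`,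
and this bound is sharp. -/
theorem Sf_eq_of_first_occurrence {f : ℕ → ℤ} (hf : FoldingSeq f) {K n Q : ℕ} (hn : 7 ≤ n)
    (hK : 2 ≤ K) (hKn : 2 ^ K < n) (hnK : n ≤ 2 ^ (K + 1)) (hQ : 2 ≤ Q)
    (hocc : ∀ m, ∃ q, 1 ≤ q ∧ q ≤ Q ∧ PF f (2 ^ (K + 2) * m) = PF f (2 ^ (K + 2) * q))
    (hnew : ∀ q, 1 ≤ q → q < Q → PF f (2 ^ (K + 2) * Q) ≠ PF f (2 ^ (K + 2) * q)) :
    Sf f n = 2 ^ (K + 2) * Q := by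
  have hpos : 0 < 2 ^ K := by positivity
  have hmem : 2 ^ (K + 2) * Q ∈
      {m | 1 ≤ m ∧ ∀ i, 1 ≤ i → ∃ j, 1 ≤ j ∧ j ≤ m ∧ FactorMatch f n i j} := by
    refine ⟨Nat.mul_pos (by positivity) (by omega), fun i hi => ?_⟩
    obtain ⟨m, d, hd, hid⟩ : ∃ m d, d < 2 ^ K ∧ i + d = 2 ^ K * m := by
      refine ⟨(i - 1) / 2 ^ K + 1, 2 ^ K - 1 - (i - 1) % 2 ^ K, by omega, ?_⟩
      have := Nat.div_add_mod (i - 1) (2 ^ K)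
      have := Nat.mod_lt (i - 1) hpos
      rw [mul_add]
      omega
    obtain ⟨m', hm1, hmQ, hpar, h0, h1⟩ := exists_eq_pair f hQ hocc m
    have hle : 2 ^ K * 1 ≤ 2 ^ K * m' := Nat.mul_le_mul_left _ hm1
    have hge : 2 ^ K * m' ≤ 2 ^ K * (4 * Q) := Nat.mul_le_mul_left _ hmQ
    rw [show 2 ^ K * (4 * Q) = 2 ^ (K + 2) * Q by ring] at hge
    exact ⟨2 ^ K * m' - d, by omega, by omega,
      factorMatch_of_eq f hnK hd hid (by omega) hpar h0 h1⟩
  refine le_antisymm (Nat.sInf_le hmem) (le_csInf ⟨_, hmem⟩ ?_)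
  rintro m ⟨-, hm⟩
  obtain ⟨j, hj1, hjm, hj⟩ := hm _ hmem.1
  refine le_trans ?_ hjm
  obtain ⟨q, rfl⟩ := dvd_of_factorMatch hf hn hK hKn hj
  refine Nat.mul_le_mul_left _ ?_
  by_contra! hlt
  exact hnew q (Nat.pos_of_mul_pos_left hj1) hlt (by simpa using hj 0 (by omega))

theorem stmt0 (f : ℕ → ℤ) (hf : FoldingSeq f) (n k : ℕ) (hn : 7 ≤ n)
    (hk1 : 2 ^ (k - 1) < n) (hk2 : n ≤ 2 ^ k) :
    (f (k + 1) ≠ f (k + 2) → Sf f n = 4 * 2 ^ k) ∧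
    (f (k + 1) = f (k + 2) → Sf f n = 6 * 2 ^ k) := by
  have hk : 3 ≤ k := by
    by_contra! hlt
    have := Nat.pow_le_pow_right (show 0 < 2 by norm_num) (show k ≤ 2 by omega)
    omega
  obtain ⟨K, rfl⟩ := Nat.exists_eq_add_of_le' (show 1 ≤ k by omega)
  rw [Nat.add_sub_cancel] at hk1
  have v1 : PF f (2 ^ (K + 2) * 1) = f (K + 2) := PF_pow_mul_one f (K + 2) 0
  have v2 : PF f (2 ^ (K + 2) * 2) = f (K + 3) := by
    rw [← PF_pow_mul_one f (K + 3) 0]; congr 1; ring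
  have v3 : PF f (2 ^ (K + 2) * 3) = -f (K + 2) := PF_pow_mul_three f (K + 2) 0
  have hb := hf (K + 2)
  have hc := hf (K + 3)
  refine ⟨fun h => ?_, fun h => ?_⟩
  · change f (K + 2) ≠ f (K + 3) at h
    rw [Sf_eq_of_first_occurrence hf (Q := 2) hn (by omega) hk1 hk2 le_rfl]
    · ring
    · intro m
      have hm := hf.PF_eq (2 ^ (K + 2) * m)
      by_cases hv : PF f (2 ^ (K + 2) * m) = f (K + 2)
      · exact ⟨1, le_rfl, by norm_num, by rw [hv, v1]⟩
      · exact ⟨2, by norm_num, le_rfl, by rw [v2]; omega⟩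
    · intro q hq1 hq2
      obtain rfl : q = 1 := by omega
      rw [v1, v2]
      exact h.symm
  · change f (K + 2) = f (K + 3) at h
    rw [Sf_eq_of_first_occurrence hf (Q := 3) hn (by omega) hk1 hk2 (by norm_num)]
    · ring
    · intro m
      have hm := hf.PF_eq (2 ^ (K + 2) * m)
      by_cases hv : PF f (2 ^ (K + 2) * m) = f (K + 2)
      · exact ⟨1, le_rfl, by norm_num, by rw [hv, v1]⟩
      · exact ⟨3, by norm_num, le_rfl, by rw [v3]; omega⟩
    · intro q hq1 hq2
      obtain rfl | rfl : q = 1 ∨ q = 2 := by omega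
      · rw [v1, v3]; omega
      · rw [v2, v3]; omega
end

section
/- Let f be a folding instruction set. Then A_f(n) = 6·φ(n) + n − 1 for all n ≥ 7 if and only if the tail (f_4, f_5, f_6, …) is constant, i.e., f = (f_0, f_1, f_2, f_3, 1, 1, 1, …) or f = (f_0, f_1, f_2, f_3, −1, −1, −1, …) for some f_0, f_1, f_2, f_3 ∈ {−1, 1}. -/
theorem PF_two_pow_mul (f : ℕ → ℤ) (s r : ℕ) (hr : r % 2 = 1) :
    PF f (2 ^ s * r) = if r % 4 = 1 then f s else -f s := by
  have hv : padicValNat 2 (2 ^ s * r) = s := by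
    rw [padicValNat.mul (by positivity) (by omega), padicValNat.prime_pow,
      padicValNat.eq_zero_of_not_dvd (by omega), add_zero]
  have hd : 2 ^ s * r / 2 ^ s = r := Nat.mul_div_cancel_left r (by positivity)
  rw [PF, hv, hd]

theorem FoldingSeq.PF_eq_one_or_neg_one {f : ℕ → ℤ} (hf : FoldingSeq f) (k : ℕ) :
    PF f k = 1 ∨ PF f k = -1 := by
  unfold PF
  rcases hf (padicValNat 2 k) with h | h <;> split_ifs <;> simp [h]

/-- Away from the multiples of `2 ^ a`, the sequence `P_f` has period `2 ^ (a + 1)`. -/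
theorem PF_add_two_pow_mul (f : ℕ → ℤ) {a k : ℕ} (hk : ¬ 2 ^ a ∣ k) (c : ℕ) :
    PF f (k + 2 ^ (a + 1) * c) = PF f k := by
  have hk0 : k ≠ 0 := by rintro rfl; simp at hk
  obtain ⟨s, r, hr, rfl⟩ := Nat.exists_eq_two_pow_mul_odd hk0
  have hs : s < a := by
    by_contra! h
    exact hk ((pow_dvd_pow 2 h).mul_right r)
  obtain ⟨d, rfl⟩ := Nat.exists_eq_add_of_lt hs
  have hr' : r % 2 = 1 := Nat.odd_iff.mp hr
  have he : 2 ^ s * r + 2 ^ (s + d + 1 + 1) * c = 2 ^ s * (r + 4 * (2 ^ d * c)) := by ring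
  rw [he, PF_two_pow_mul f s _ (by omega), PF_two_pow_mul f s r hr', Nat.add_mul_mod_self_left]

theorem PF_eq_of_modEq (f : ℕ → ℤ) {a k l : ℕ} (hk : ¬ 2 ^ a ∣ k)
    (h : k ≡ l [MOD 2 ^ (a + 1)]) : PF f k = PF f l := by
  have hl : ¬ 2 ^ a ∣ l := by
    rwa [← (h.of_dvd (pow_dvd_pow 2 a.le_succ)).dvd_iff dvd_rfl]
  have key : ∀ x, ¬ 2 ^ a ∣ x → PF f x = PF f (x % 2 ^ (a + 1)) := by
    intro x hx
    have hx' : ¬ 2 ^ a ∣ x % 2 ^ (a + 1) := by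
      rwa [Nat.dvd_mod_iff (pow_dvd_pow 2 a.le_succ)]
    conv_lhs => rw [← Nat.mod_add_div x (2 ^ (a + 1))]
    exact PF_add_two_pow_mul f hx' _
  rw [key k hk, key l hl, h]

/-- Two windows of length at most `2 ^ a` at the same position modulo `2 ^ (a + 1)` agree as soon
as they agree at the multiple of `2 ^ a` they contain. -/
theorem factorMatch_of_modEq {f : ℕ → ℤ} {a n i j : ℕ} (h : i ≡ j [MOD 2 ^ (a + 1)])
    (hmul : ∀ t, t < n → 2 ^ a ∣ i + t → PF f (i + t) = PF f (j + t)) : FactorMatch f n i j := by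
  intro t ht
  by_cases hd : 2 ^ a ∣ i + t
  · exact hmul t ht hd
  · exact PF_eq_of_modEq f hd (h.add_right t)

theorem exists_factorMatch_le {f : ℕ → ℤ} (hf : FoldingSeq f) {a n B : ℕ} (hn : n ≤ 2 ^ a)
    (hB : 3 ≤ B)
    (heven : ∀ v : ℤ, v = 1 ∨ v = -1 → ∃ q, 1 ≤ q ∧ q ≤ B ∧ q % 2 = 0 ∧ PF f (2 ^ a * q) = v)
    (i : ℕ) : ∃ j, 1 ≤ j ∧ j ≤ 2 ^ a * B ∧ FactorMatch f n i j := by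
  have hodd : ∀ v : ℤ, v = 1 ∨ v = -1 →
      ∃ q, 1 ≤ q ∧ q ≤ B ∧ q % 2 = 1 ∧ PF f (2 ^ a * q) = v := by
    intro v hv
    have h1 := PF_two_pow_mul f a 1 rfl
    have h3 := PF_two_pow_mul f a 3 rfl
    norm_num at h1 h3
    by_cases h : v = f a
    · exact ⟨1, by omega, by omega, rfl, by simp [h1, h]⟩
    · refine ⟨3, by omega, by omega, rfl, ?_⟩
      rw [h3]
      rcases hf a with h' | h' <;> omega
  have hpos : 0 < 2 ^ a := by positivity
  by_cases hex : ∃ t, t < n ∧ 2 ^ a ∣ i + t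
  · obtain ⟨t, ht, p, hp⟩ := hex
    have hq : ∃ q, 1 ≤ q ∧ q ≤ B ∧ q % 2 = p % 2 ∧ PF f (2 ^ a * q) = PF f (2 ^ a * p) := by
      rcases Nat.mod_two_eq_zero_or_one p with h | h <;> rw [h]
      · exact heven _ (hf.PF_eq_one_or_neg_one _)
      · exact hodd _ (hf.PF_eq_one_or_neg_one _)
    obtain ⟨q, hq1, hqB, hqp, hPF⟩ := hq
    have hle : 2 ^ a ≤ 2 ^ a * q := Nat.le_mul_of_pos_right _ hq1
    have hjt : 2 ^ a * q - t + t = 2 ^ a * q := by omega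
    refine ⟨2 ^ a * q - t, by omega, (Nat.sub_le _ _).trans (Nat.mul_le_mul_left _ hqB), ?_⟩
    apply factorMatch_of_modEq (a := a)
    · apply Nat.ModEq.add_right_cancel' t
      rw [hjt, hp, pow_succ]
      exact Nat.ModEq.mul_left' _ hqp.symm
    · intro u hu hdu
      have htu : u = t := by
        have h1 : i + u ≡ i + t [MOD 2 ^ a] :=
          (Nat.modEq_zero_iff_dvd.mpr hdu).trans
            (Nat.modEq_zero_iff_dvd.mpr ⟨p, hp⟩).symm
        exact (Nat.ModEq.add_left_cancel' i h1).eq_of_lt_of_lt (by omega) (by omega)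
      rw [htu, hjt, hp, hPF]
  · push Not at hex
    by_cases hn0 : n = 0
    · subst hn0
      exact ⟨1, le_rfl, by nlinarith, fun t ht => absurd ht (by omega)⟩
    refine ⟨i % 2 ^ (a + 1), ?_, ?_, ?_⟩
    · by_contra! h
      apply hex 0 (by omega)
      exact (pow_dvd_pow 2 a.le_succ).trans (Nat.dvd_of_mod_eq_zero (Nat.lt_one_iff.mp h))
    · have : i % 2 ^ (a + 1) < 2 ^ (a + 1) := Nat.mod_lt _ (by positivity)
      rw [pow_succ] at this ⊢
      nlinarith
    · exact factorMatch_of_modEq (Nat.mod_modEq _ _).symm fun t ht hd => absurd hd (hex t ht)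

/-- Among `2 ^ a * 2`, `2 ^ a * 4` and `2 ^ a * 6` both values of `P_f` already occur. -/
theorem exists_even_PF_eq {f : ℕ → ℤ} (hf : FoldingSeq f) (a : ℕ) {v : ℤ}
    (hv : v = 1 ∨ v = -1) :
    ∃ q, 1 ≤ q ∧ q ≤ 6 ∧ q % 2 = 0 ∧ PF f (2 ^ a * q) = v := by
  have h1 := PF_two_pow_mul f (a + 1) 1 rfl
  have h3 := PF_two_pow_mul f (a + 1) 3 rfl
  norm_num [pow_succ, mul_assoc] at h1 h3
  by_cases h : v = f (a + 1)
  · exact ⟨2, by omega, by omega, rfl, by rw [h1, h]⟩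
  · refine ⟨6, by omega, by omega, rfl, ?_⟩
    rw [h3]
    rcases hf (a + 1) with h' | h' <;> omega

theorem exists_even_PF_eq_of_ne {f : ℕ → ℤ} (hf : FoldingSeq f) {a : ℕ}
    (hne : f (a + 1) ≠ f (a + 2)) {v : ℤ} (hv : v = 1 ∨ v = -1) :
    ∃ q, 1 ≤ q ∧ q ≤ 4 ∧ q % 2 = 0 ∧ PF f (2 ^ a * q) = v := by
  have h1 := PF_two_pow_mul f (a + 1) 1 rfl
  have h2 := PF_two_pow_mul f (a + 2) 1 rfl
  norm_num [pow_succ, mul_assoc] at h1 h2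
  by_cases h : v = f (a + 1)
  · exact ⟨2, by omega, by omega, rfl, by rw [h1, h]⟩
  · refine ⟨4, by omega, by omega, rfl, ?_⟩
    rw [h2]
    rcases hf (a + 1) with h' | h' <;> rcases hf (a + 2) with h'' | h'' <;> omega

theorem Af_le {f : ℕ → ℤ} {n M : ℕ} (hn : 1 ≤ n)
    (h : ∀ i, 1 ≤ i → ∃ j, 1 ≤ j ∧ j ≤ M ∧ FactorMatch f n i j) : Af f n ≤ M + n - 1 := by
  apply Nat.sInf_le
  refine ⟨?_, fun i hi => ?_⟩
  · obtain ⟨j, hj, hjM, -⟩ := h 1 le_rfl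
    omega
  · obtain ⟨j, hj, hjM, hm⟩ := h i hi
    exact ⟨j, hj, by omega, hm⟩

theorem Af_eq {f : ℕ → ℤ} {n M : ℕ} (hn : 1 ≤ n) (hM : 1 ≤ M)
    (h : ∀ i, 1 ≤ i → ∃ j, 1 ≤ j ∧ j ≤ M ∧ FactorMatch f n i j)
    (hlast : ∀ j, 1 ≤ j → FactorMatch f n M j → M ≤ j) : Af f n = M + n - 1 := by
  refine le_antisymm (Af_le hn h) (le_csInf ⟨M + n - 1, by omega, fun i hi => ?_⟩ ?_)
  · obtain ⟨j, hj, hjM, hm⟩ := h i hi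
    exact ⟨j, hj, by omega, hm⟩
  · rintro m ⟨-, hm⟩
    obtain ⟨j, hj, hjm, hmatch⟩ := hm M hM
    have := hlast j hj hmatch
    omega

theorem PF_odd (f : ℕ → ℤ) {k : ℕ} (hk : k % 2 = 1) :
    PF f k = if k % 4 = 1 then f 0 else -f 0 := by
  simpa using PF_two_pow_mul f 0 k hk

theorem even_of_PF_add_eq {f : ℕ → ℤ} (hf : FoldingSeq f) {j : ℕ}
    (h2 : PF f (j + 2) = PF f 2) (h6 : PF f (j + 6) = PF f 6) : 2 ∣ j := by
  by_contra hj
  have e2 := PF_two_pow_mul f 1 1 rfl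
  have e6 := PF_two_pow_mul f 1 3 rfl
  norm_num at e2 e6
  have hjj : PF f (j + 6) = PF f (j + 2) := by
    rw [PF_odd f (by omega), PF_odd f (by omega), show (j + 6) % 4 = (j + 2) % 4 by omega]
  apply hf.ne_neg 1
  rw [← e6, ← e2, ← h6, ← h2, hjj]

theorem two_pow_dvd_of_PF_add_eq {f : ℕ → ℤ} (hf : FoldingSeq f) {j : ℕ} (hj : 2 ∣ j) (a : ℕ)
    (h : ∀ s, s < a → PF f (j + 2 ^ s) = PF f (2 ^ s)) : 2 ^ (a + 1) ∣ j := by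
  induction a with
  | zero => simpa using hj
  | succ a ih =>
    obtain ⟨c, rfl⟩ := ih fun s hs => h s (by omega)
    have ha := h a (by omega)
    have e1 := PF_two_pow_mul f a 1 rfl
    rw [mul_one] at e1
    rw [show 2 ^ (a + 1) * c + 2 ^ a = 2 ^ a * (2 * c + 1) by ring,
      PF_two_pow_mul f a _ (by omega), e1] at ha
    have hc : 2 ∣ c := by
      by_contra hc
      rw [if_neg (by omega), if_pos (by norm_num)] at ha
      exact hf.ne_neg a ha.symm
    rw [pow_succ 2 (a + 1)]
    exact Nat.mul_dvd_mul_left _ hc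

theorem le_of_factorMatch {f : ℕ → ℤ} (hf : FoldingSeq f) {a n : ℕ} (h7 : 7 ≤ n)
    (hn : n ≤ 2 ^ a) (hn' : 2 ^ (a - 1) < n) (heq : f (a + 1) = f (a + 2)) {j : ℕ} (hj : 1 ≤ j)
    (h : FactorMatch f n (2 ^ a * 6) j) : 2 ^ a * 6 ≤ j := by
  have hP : ∀ t, 1 ≤ t → t < n → PF f (j + t) = PF f t := by
    intro t ht htn
    rw [← h t htn]
    refine PF_eq_of_modEq f (a := a) ?_ ?_
    · rw [Nat.dvd_add_right (Dvd.intro _ rfl)]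
      exact Nat.not_dvd_of_pos_of_lt ht (by omega)
    · rw [show 2 ^ a * 6 + t = t + 2 ^ (a + 1) * 3 by ring]
      simp [Nat.ModEq]
  have heven := even_of_PF_add_eq hf (hP 2 (by omega) (by omega)) (hP 6 (by omega) (by omega))
  obtain ⟨r, rfl⟩ := two_pow_dvd_of_PF_add_eq hf heven a fun s hs =>
    hP _ Nat.one_le_two_pow ((Nat.pow_le_pow_right (by norm_num) (by omega)).trans_lt hn')
  have h0 := h 0 (by omega)
  have h1 := PF_two_pow_mul f (a + 1) 1 rfl
  have h2 := PF_two_pow_mul f (a + 2) 1 rfl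
  have h3 := PF_two_pow_mul f (a + 1) 3 rfl
  norm_num at h1 h2 h3
  rw [add_zero, add_zero, show 2 ^ a * 6 = 2 ^ (a + 1) * 3 by ring, h3] at h0
  rw [show 2 ^ a * 6 = 2 ^ (a + 1) * 3 by ring]
  apply Nat.mul_le_mul_left
  by_contra! hr
  have hr0 : r ≠ 0 := by rintro rfl; simp at hj
  obtain rfl | rfl : r = 1 ∨ r = 2 := by omega
  · rw [mul_one, h1] at h0
    exact hf.ne_neg _ h0.symm
  · rw [← pow_succ, h2, ← heq] at h0
    exact hf.ne_neg _ h0.symm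

theorem Af_eq_of_tail_eq {f : ℕ → ℤ} (hf : FoldingSeq f) (hs : ∀ s, 4 ≤ s → f s = f (s + 1))
    {n : ℕ} (h7 : 7 ≤ n) : Af f n = 6 * phi2 n + n - 1 := by
  have hn : n ≤ 2 ^ Nat.clog 2 n := Nat.le_pow_clog (by norm_num) n
  have hn' : 2 ^ (Nat.clog 2 n - 1) < n := Nat.pow_pred_clog_lt_self (by norm_num) (by omega)
  have ha : 3 ≤ Nat.clog 2 n := by
    by_contra! h
    have : 2 ^ Nat.clog 2 n ≤ 2 ^ 2 := Nat.pow_le_pow_right (by norm_num) (by omega)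
    omega
  rw [phi2, mul_comm]
  exact Af_eq (by omega) (by omega)
    (fun i _ => exists_factorMatch_le hf hn (by norm_num) (fun v hv => exists_even_PF_eq hf _ hv) i)
    (fun j hj hm => le_of_factorMatch hf h7 hn hn' (hs _ (by omega)) hj hm)

theorem stmt3 (f : ℕ → ℤ) (hf : FoldingSeq f) :
    (∀ n, 7 ≤ n → Af f n = 6 * phi2 n + n - 1) ↔
      ((∀ s, 4 ≤ s → f s = 1) ∨ (∀ s, 4 ≤ s → f s = -1)) := by
  constructor
  · intro h
    have hs : ∀ s, 4 ≤ s → f s = f (s + 1) := by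
      intro s hs
      obtain ⟨a, rfl⟩ : ∃ a, s = a + 1 := ⟨s - 1, by omega⟩
      by_contra hne
      have h8 : 2 ^ 3 ≤ 2 ^ a := Nat.pow_le_pow_right (by norm_num) (by omega)
      have heq := h (2 ^ a) (by omega)
      have hle := Af_le (M := 2 ^ a * 4) (by omega) fun i _ =>
        exists_factorMatch_le hf (le_refl (2 ^ a)) (by norm_num)
          (fun v hv => exists_even_PF_eq_of_ne hf hne hv) i
      rw [phi2, Nat.clog_pow 2 a (by norm_num)] at heq
      omega
    have hc : ∀ s, 4 ≤ s → f s = f 4 := fun s h4 => by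
      induction s, h4 using Nat.le_induction with
      | base => rfl
      | succ s h4 ih => rw [← hs s h4, ih]
    exact (hf 4).imp (fun h4 s h => (hc s h).trans h4) fun h4 s h => (hc s h).trans h4
  · rintro (h | h) n hn <;>
      exact Af_eq_of_tail_eq hf (fun s hs => by rw [h s hs, h (s + 1) (by omega)]) hn
end

section
/- Let f be a folding instruction set and n ≥ 7 with 2^(k-1) < n ≤ 2^k. Then the length-n factor P_f[6·2^k : 6·2^k + n − 1] and the length-2^k factor P_f[6·2^k : 6·2^k + 2^k − 1] first appear in P_f at the same starting index; in particular, if the length-n factor starting at 6·2^k also occurs starting at 4·2^k, then so does the length-2^k factor starting at 6·2^k. -/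
theorem padicValNat_two_pow_mul_odd (s r : ℕ) (hr : r % 2 = 1) :
    padicValNat 2 (2 ^ s * r) = s := by
  have h0 : r ≠ 0 := by omega
  rw [padicValNat.mul (by positivity) h0, padicValNat.prime_pow,
    padicValNat.eq_zero_of_not_dvd (by omega), add_zero]

theorem PF_of_mod_four_eq_one (f : ℕ → ℤ) (s r : ℕ) (hr : r % 4 = 1) :
    PF f (2 ^ s * r) = f s := by
  rw [PF, padicValNat_two_pow_mul_odd s r (by omega), Nat.mul_div_cancel_left _ (by positivity),
    if_pos hr]

theorem PF_of_mod_four_eq_three (f : ℕ → ℤ) (s r : ℕ) (hr : r % 4 = 3) :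
    PF f (2 ^ s * r) = -f s := by
  rw [PF, padicValNat_two_pow_mul_odd s r (by omega), Nat.mul_div_cancel_left _ (by positivity),
    if_neg (by omega)]

/-- Shifting by a multiple of `2 ^ (k + 1)` does not change `P_f` at indices below `2 ^ k`. -/
theorem PF_add_of_dvd (f : ℕ → ℤ) {k a t : ℕ} (ha : 2 ^ (k + 1) ∣ a) (h0 : t ≠ 0)
    (ht : t < 2 ^ k) : PF f (a + t) = PF f t := by
  obtain ⟨s, r, ⟨u, hr⟩, rfl⟩ := Nat.exists_eq_two_pow_mul_odd h0
  have hs : s < k := (Nat.pow_lt_pow_iff_right (by norm_num : 1 < 2)).1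
    (lt_of_le_of_lt (Nat.le_mul_of_pos_right _ (by omega)) ht)
  obtain ⟨c, rfl⟩ : 2 ^ (s + 2) ∣ a := (pow_dvd_pow 2 (by omega)).trans ha
  have e : 2 ^ (s + 2) * c + 2 ^ s * r = 2 ^ s * (4 * c + r) := by ring
  rw [e]
  rcases (by omega : r % 4 = 1 ∨ r % 4 = 3) with h | h
  · rw [PF_of_mod_four_eq_one f s r h, PF_of_mod_four_eq_one f s _ (by omega)]
  · rw [PF_of_mod_four_eq_three f s r h, PF_of_mod_four_eq_three f s _ (by omega)]

theorem PF_add_four_of_odd (f : ℕ → ℤ) {j : ℕ} (hj : j % 2 = 1) : PF f (j + 4) = PF f j := by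
  rcases (by omega : j % 4 = 1 ∨ j % 4 = 3) with h | h
  · have h₁ := PF_of_mod_four_eq_one f 0 j h
    have h₂ := PF_of_mod_four_eq_one f 0 (j + 4) (by omega)
    simp_all
  · have h₁ := PF_of_mod_four_eq_three f 0 j h
    have h₂ := PF_of_mod_four_eq_three f 0 (j + 4) (by omega)
    simp_all

/-- An occurrence of a long enough prefix of the factor at `6 * 2 ^ k` is aligned. -/
theorem two_pow_succ_dvd_of_factorMatch {f : ℕ → ℤ} (hf : FoldingSeq f) {n k j : ℕ} (hn : 7 ≤ n)
    (hk : 3 ≤ k) (hkn : 2 ^ (k - 1) < n) (hj : 1 ≤ j) (h : FactorMatch f n (6 * 2 ^ k) j) :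
    2 ^ (k + 1) ∣ j := by
  have h8 : 2 ^ 3 ≤ 2 ^ k := Nat.pow_le_pow_right (by norm_num) hk
  have hi : 2 ^ (k + 1) ∣ 6 * 2 ^ k := ⟨3, by ring⟩
  obtain ⟨m, r, ⟨u, hr⟩, rfl⟩ := Nat.exists_eq_two_pow_mul_odd (by omega : j ≠ 0)
  by_cases hm : k + 1 ≤ m
  · exact (pow_dvd_pow 2 hm).trans (dvd_mul_right _ _)
  exfalso
  rcases m with _ | m
  · have h₂ := h 2 (by omega)
    have h₆ := h 6 (by omega)
    rw [PF_add_of_dvd f hi (by norm_num) (by omega)] at h₂ h₆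
    have e : PF f (2 ^ 0 * r + 6) = PF f (2 ^ 0 * r + 2) :=
      PF_add_four_of_odd f (j := 2 ^ 0 * r + 2) (by omega)
    have p₂ : PF f 2 = f 1 := PF_of_mod_four_eq_one f 1 1 rfl
    have p₆ : PF f 6 = -f 1 := PF_of_mod_four_eq_three f 1 3 rfl
    exact hf.ne_neg 1 (by rw [← p₆, ← p₂, h₂, h₆, e])
  · have hle : 2 ^ m ≤ 2 ^ (k - 1) := Nat.pow_le_pow_right (by norm_num) (by omega)
    have hlt : 2 ^ m < 2 ^ k := Nat.pow_lt_pow_right (by norm_num) (by omega)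
    have ht := h (2 ^ m) (by omega)
    have e : 2 ^ (m + 1) * r + 2 ^ m = 2 ^ m * (2 * r + 1) := by ring
    have p : PF f (2 ^ m) = f m := by simpa using PF_of_mod_four_eq_one f m 1 rfl
    rw [PF_add_of_dvd f hi (by positivity) hlt, e,
      PF_of_mod_four_eq_three f m _ (by omega), p] at ht
    exact hf.ne_neg m ht

theorem factorMatch_two_pow_iff {f : ℕ → ℤ} (hf : FoldingSeq f) {n k j : ℕ} (hn : 7 ≤ n)
    (hk1 : 2 ^ (k - 1) < n) (hk2 : n ≤ 2 ^ k) (hj : 1 ≤ j) :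
    FactorMatch f n (6 * 2 ^ k) j ↔ FactorMatch f (2 ^ k) (6 * 2 ^ k) j := by
  refine ⟨fun h t ht => ?_, fun h t ht => h t (ht.trans_le hk2)⟩
  have hk : 3 ≤ k := by
    by_contra hk
    have : 2 ^ k ≤ 2 ^ 2 := Nat.pow_le_pow_right (by norm_num) (by omega)
    omega
  rcases eq_or_ne t 0 with rfl | h0
  · exact h 0 (by omega)
  · rw [PF_add_of_dvd f (two_pow_succ_dvd_of_factorMatch hf hn hk hk1 hj h) h0 ht,
      PF_add_of_dvd f ⟨3, by ring⟩ h0 ht]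

theorem stmt6 (f : ℕ → ℤ) (hf : FoldingSeq f) (n k : ℕ) (hn : 7 ≤ n)
    (hk1 : 2 ^ (k - 1) < n) (hk2 : n ≤ 2 ^ k) :
    sInf {j | 1 ≤ j ∧ FactorMatch f n (6 * 2 ^ k) j} =
      sInf {j | 1 ≤ j ∧ FactorMatch f (2 ^ k) (6 * 2 ^ k) j} ∧
    (FactorMatch f n (6 * 2 ^ k) (4 * 2 ^ k) →
      FactorMatch f (2 ^ k) (6 * 2 ^ k) (4 * 2 ^ k)) := by
  have key : ∀ j, 1 ≤ j →
      (FactorMatch f n (6 * 2 ^ k) j ↔ FactorMatch f (2 ^ k) (6 * 2 ^ k) j) :=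
    fun j hj => factorMatch_two_pow_iff hf hn hk1 hk2 hj
  refine ⟨?_, (key _ (Nat.succ_le_of_lt (by positivity))).1⟩
  congr 1
  ext j
  exact and_congr_right (key j)
end
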